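/- Let π = (5^3, 4^i, 3^j, 2^{n−3−i−j}) where n ≥ 6, i, j ≥ 0, i + j ≥ 3, i + j ≤ n − 3, and σ(π) is even. Then π is potentially K6−C5-graphic if and only if π ≠ (5^3, 3^3). -/

import Mathlib

/-- The degree of vertex `i` in the simple graph `G`. -/
noncomputable def degCount {n : ℕ} (G : SimpleGraph (Fin n)) (i : Fin n) : ℕ :=
  {j | G.Adj i j}.ncard

/-- The graph `K₆ − C₅`: the complete graph on 6 vertices minus the edges of a
cycle on 5 of its vertices.  Vertex `0` is adjacent to all other vertices, and the
vertices `1,…,5` carry the complement of a 5-cycle (which is again a 5-cycle).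
Its degree sequence is `(5,3,3,3,3,3)`. -/
def K6C5 : SimpleGraph (Fin 6) :=
  SimpleGraph.fromRel (fun a b =>
    a = 0 ∨ b = 0 ∨
      (a, b) ∈ ([(1, 3), (3, 5), (5, 2), (2, 4), (4, 1)] : List (Fin 6 × Fin 6)))

/-- A list of natural numbers is graphic if it is the degree sequence of some
simple graph. -/
def IsGraphic (l : List ℕ) : Prop :=
  ∃ G : SimpleGraph (Fin l.length), ∀ i : Fin l.length, degCount G i = l.get i

/-- A list of natural numbers is potentially `K₆ − C₅`-graphic if it has a
realization containing `K₆ − C₅` as a subgraph. -/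
def PotentiallyK6C5 (l : List ℕ) : Prop :=
  ∃ G : SimpleGraph (Fin l.length),
    (∀ i : Fin l.length, degCount G i = l.get i) ∧
    ∃ f : Fin 6 → Fin l.length, Function.Injective f ∧
      ∀ a b : Fin 6, K6C5.Adj a b → G.Adj (f a) (f b)

open Finset in
/-- Two functions on finite types with the same multiset of values differ by a bijection. -/
theorem Multiset.exists_equiv_of_map_univ_eq {V W γ : Type*} [Fintype V] [Fintype W]
    {f : V → γ} {g : W → γ}
    (h : (univ : Finset V).val.map f = (univ : Finset W).val.map g) :
    ∃ e : V ≃ W, ∀ v, g (e v) = f v := by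
  classical
  have hcard (c : γ) : Nonempty ({v // f v = c} ≃ {w // g w = c}) := by
    refine ⟨Fintype.equivOfCardEq ?_⟩
    have hc := congrArg (Multiset.count c) h
    simp only [Multiset.count_map] at hc
    simp only [Fintype.card_subtype, Finset.card_def, Finset.filter_val]
    simpa only [eq_comm] using hc
  have e c := (hcard c).some
  refine ⟨(Equiv.sigmaFiberEquiv f).symm.trans
    ((Equiv.sigmaCongrRight e).trans (Equiv.sigmaFiberEquiv g)), fun v => ?_⟩
  exact (e (f v) ⟨v, rfl⟩).2

theorem swap_involutive {V : Type*} [DecidableEq V] (a b : V) :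
    Function.Involutive (Equiv.swap a b) := fun v => Equiv.swap_apply_self a b v

instance : DecidableRel K6C5.Adj :=
  inferInstanceAs (DecidableRel (SimpleGraph.fromRel _).Adj)

namespace SimpleGraph

variable {V : Type}

/-- The multiset of vertex degrees. -/
noncomputable def degrees [Fintype V] (G : SimpleGraph V) : Multiset ℕ :=
  (Finset.univ : Finset V).val.map fun v => {w | G.Adj v w}.ncard

theorem degrees_option [Fintype V] (G : SimpleGraph (Option V)) :
    G.degrees = {w | G.Adj none w}.ncard ::ₘ
      (Finset.univ : Finset V).val.map fun v => {w | G.Adj (some v) w}.ncard := by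
  simp [degrees, univ_option, Finset.insertNone]

theorem potentiallyK6C5_of_degrees_eq [Fintype V] {G : SimpleGraph V} {l : List ℕ}
    (hdeg : G.degrees = l) (hG : K6C5 ⊑ G) : PotentiallyK6C5 l := by
  obtain ⟨e, he⟩ := Multiset.exists_equiv_of_map_univ_eq
    (f := fun v => {w | G.Adj v w}.ncard) (g := l.get)
    (hdeg.trans (by rw [Fin.univ_val_map, List.ofFn_get]))
  obtain ⟨c⟩ := hG
  refine ⟨G.comap e.symm, fun i => ?_, fun a => e (c a), e.injective.comp c.injective,
    fun a b hab => ?_⟩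
  · have := he (e.symm i)
    rw [Equiv.apply_symm_apply] at this
    rw [this]
    exact Set.ncard_preimage_of_injective_subset_range (s := {w | G.Adj (e.symm i) w})
      e.symm.injective (by simp)
  · simpa using c.toHom.map_adj hab

/-- Delete every edge joining a vertex `v` to `p v ≠ v`, and join all such `v` to a new vertex. -/
def pinch (G : SimpleGraph V) (p : V → V) (hp : Function.Involutive p) :
    SimpleGraph (Option V) where
  Adj
    | none, none => False
    | none, some v => p v ≠ v
    | some v, none => p v ≠ v
    | some u, some v => G.Adj u v ∧ v ≠ p u
  symm := ⟨by
    rintro (_ | u) (_ | v)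
    · exact id
    · exact id
    · exact id
    · rintro ⟨h, hne⟩
      exact ⟨h.symm, fun h' => hne (by rw [h', hp])⟩⟩
  loopless := ⟨by
    rintro (_ | u)
    · exact id
    · exact fun h => G.irrefl h.1⟩

section pinch

variable (G : SimpleGraph V) (p : V → V) (hp : Function.Involutive p)

@[simp] theorem pinch_adj_none_none : ¬(G.pinch p hp).Adj none none := id

@[simp] theorem pinch_adj_none_some {v : V} :
    (G.pinch p hp).Adj none (some v) ↔ p v ≠ v := Iff.rfl

@[simp] theorem pinch_adj_some_none {v : V} :
    (G.pinch p hp).Adj (some v) none ↔ p v ≠ v := Iff.rfl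

@[simp] theorem pinch_adj_some_some {u v : V} :
    (G.pinch p hp).Adj (some u) (some v) ↔ G.Adj u v ∧ v ≠ p u := Iff.rfl

theorem ncard_pinch_none : {w | (G.pinch p hp).Adj none w}.ncard = {v | p v ≠ v}.ncard := by
  rw [← Set.ncard_image_of_injective _ (Option.some_injective V)]
  congr 1
  ext (_ | v) <;> simp

theorem ncard_pinch_some [Finite V] (hG : ∀ v, p v ≠ v → G.Adj v (p v)) (v : V) :
    {w | (G.pinch p hp).Adj (some v) w}.ncard = {w | G.Adj v w}.ncard := by
  by_cases hv : p v = v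
  · rw [← Set.ncard_image_of_injective {w | G.Adj v w} (Option.some_injective V)]
    congr 1
    ext (_ | w)
    · simp [hv]
    · simpa [hv] using fun h : G.Adj v w => h.ne'
  · have hset : {w | (G.pinch p hp).Adj (some v) w} =
        insert none (some '' ({w | G.Adj v w} \ {p v})) := by
      ext (_ | w) <;> simp [hv]
    rw [hset, Set.ncard_insert_of_notMem (by simp),
      Set.ncard_image_of_injective _ (Option.some_injective V),
      Set.ncard_sdiff_singleton_add_one (show p v ∈ {w | G.Adj v w} from hG v hv)]

theorem degrees_pinch [Fintype V] (hG : ∀ v, p v ≠ v → G.Adj v (p v)) :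
    (G.pinch p hp).degrees = {v | p v ≠ v}.ncard ::ₘ G.degrees := by
  rw [degrees_option, ncard_pinch_none]
  simp only [ncard_pinch_some G p hp hG]
  rfl

theorem map_some_le_pinch {H : SimpleGraph V} (hHG : H ≤ G) (hH : ∀ v, ¬H.Adj v (p v)) :
    H.map some ≤ G.pinch p hp := by
  rintro _ _ ⟨-, u, v, huv, rfl, rfl⟩
  exact ⟨hHG huv, fun h => hH u (h ▸ huv)⟩

end pinch

theorem isContained_map_some {W : Type} {K : SimpleGraph W} {H : SimpleGraph V} (h : K ⊑ H) :
    K ⊑ H.map some :=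
  h.trans (Embedding.map Function.Embedding.some H).isContained

@[simp] theorem map_some_adj_some_some {H : SimpleGraph V} {u v : V} :
    (H.map some).Adj (some u) (some v) ↔ H.Adj u v :=
  map_adj_apply (f := Function.Embedding.some)

@[simp] theorem not_map_some_adj_none {H : SimpleGraph V} {w : Option V} :
    ¬(H.map some).Adj none w := by
  rintro ⟨-, u, v, -, h, -⟩
  cases h

theorem ncard_sup_edge_left [Finite V] {G : SimpleGraph V} {x y : V} (hxy : x ≠ y)
    (h : ¬G.Adj x y) : {w | (G ⊔ edge x y).Adj x w}.ncard = {w | G.Adj x w}.ncard + 1 := by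
  have hset : {w | (G ⊔ edge x y).Adj x w} = insert y {w | G.Adj x w} := by
    ext w
    simp only [sup_adj, edge_adj, Set.mem_ofPred_eq, Set.mem_insert_iff]
    grind
  rw [hset, Set.ncard_insert_of_notMem (s := {w | G.Adj x w}) h]

theorem ncard_sup_edge_of_ne {G : SimpleGraph V} {x y v : V} (hx : v ≠ x) (hy : v ≠ y) :
    {w | (G ⊔ edge x y).Adj v w}.ncard = {w | G.Adj v w}.ncard := by
  congr 1
  ext w
  simp [edge_adj, hx, hy]

section subdivide

variable [DecidableEq V] (G : SimpleGraph V) {H : SimpleGraph V} {a b : V}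

/-- Replace the edge between `a` and `b` by a path of length two through a new vertex. -/
def subdivide (a b : V) : SimpleGraph (Option V) :=
  G.pinch (Equiv.swap a b) (swap_involutive a b)

theorem subdivide_adj_none_some (hne : a ≠ b) {v : V} :
    (G.subdivide a b).Adj none (some v) ↔ v = a ∨ v = b := by
  rw [subdivide, pinch_adj_none_some]
  grind

theorem subdivide_adj_some_some {u v : V} (huv : s(u, v) ≠ s(a, b)) :
    (G.subdivide a b).Adj (some u) (some v) ↔ G.Adj u v := by
  rw [subdivide, pinch_adj_some_some, and_iff_left_iff_imp]
  intro h
  have := h.ne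
  grind

variable {G}

theorem adj_swap_of_ne (hab : G.Adj a b) {v : V} (hv : Equiv.swap a b v ≠ v) :
    G.Adj v (Equiv.swap a b v) := by
  have := hab.symm
  grind

theorem not_adj_swap (hab : ¬G.Adj a b) (v : V) : ¬G.Adj v (Equiv.swap a b v) := by
  have := hab ∘ Adj.symm
  have := G.irrefl (v := v)
  grind

theorem ncard_subdivide_none (hne : a ≠ b) :
    {w | (G.subdivide a b).Adj none w}.ncard = 2 := by
  rw [subdivide, ncard_pinch_none, ← Set.ncard_pair hne]
  congr 1
  ext v
  grind

theorem ncard_subdivide_some [Finite V] (hab : G.Adj a b) (v : V) :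
    {w | (G.subdivide a b).Adj (some v) w}.ncard = {w | G.Adj v w}.ncard :=
  ncard_pinch_some _ _ _ (fun _ => adj_swap_of_ne hab) v

theorem degrees_subdivide [Fintype V] (hab : G.Adj a b) :
    (G.subdivide a b).degrees = 2 ::ₘ G.degrees := by
  rw [degrees_option, ncard_subdivide_none hab.ne]
  simp only [ncard_subdivide_some hab]
  rfl

theorem map_some_le_subdivide (hHG : H ≤ G) (hab : ¬H.Adj a b) :
    H.map some ≤ G.subdivide a b :=
  map_some_le_pinch _ _ _ hHG (not_adj_swap hab)

end subdivide

/-- The graph `F` has three edges, two of which are disjoint. -/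
def HasThreeEdges (F : SimpleGraph V) : Prop :=
  ∃ a b c d x y, F.Adj a b ∧ F.Adj c d ∧ F.Adj x y ∧ a ≠ c ∧ a ≠ d ∧ b ≠ c ∧ b ≠ d ∧
    s(x, y) ≠ s(a, b) ∧ s(x, y) ≠ s(c, d)

end SimpleGraph

open SimpleGraph

/-- The multiset `s` is the degree sequence of a graph that contains `K₆ − C₅` and, outside it,
three edges, two of which are disjoint. -/
def HasExtensibleRealization (s : Multiset ℕ) : Prop :=
  ∃ (V : Type) (_ : Fintype V) (G H : SimpleGraph V), G.degrees = s ∧ H ≤ G ∧ K6C5 ⊑ H ∧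
    HasThreeEdges (G \ H)

namespace HasExtensibleRealization

variable {s : Multiset ℕ}

theorem potentiallyK6C5 {l : List ℕ} (h : HasExtensibleRealization l) : PotentiallyK6C5 l := by
  obtain ⟨V, _, G, H, hdeg, hHG, hK, -⟩ := h
  exact potentiallyK6C5_of_degrees_eq hdeg (hK.mono_right hHG)

theorem cons_two (h : HasExtensibleRealization s) : HasExtensibleRealization (2 ::ₘ s) := by
  classical
  obtain ⟨V, _, G, H, rfl, hHG, hK, a, b, c, d, x, y, hab, hcd, -, hac, had, hbc, hbd, -⟩ := h
  rw [sdiff_adj] at hab hcd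
  have hne := hab.1.ne
  refine ⟨Option V, inferInstance, G.subdivide a b, H.map some, degrees_subdivide hab.1,
    map_some_le_subdivide hHG hab.2, isContained_map_some hK,
    none, some a, some c, some d, none, some b, ?_⟩
  simp only [sdiff_adj, subdivide_adj_none_some _ hne, map_some_adj_some_some,
    not_map_some_adj_none, subdivide_adj_some_some (G := G) (show s(c, d) ≠ s(a, b) by grind)]
  grind

theorem cons_four (h : HasExtensibleRealization s) : HasExtensibleRealization (4 ::ₘ s) := by
  classical
  obtain ⟨V, _, G, H, rfl, hHG, hK, a, b, c, d, x, y, hab, hcd, hxy, hac, had, hbc, hbd,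
    hxy₁, hxy₂⟩ := h
  rw [sdiff_adj] at hab hcd hxy
  have hne := hab.1.ne
  have hne' := hcd.1.ne
  have hne'' := hxy.1.ne
  set p : V → V := fun v => Equiv.swap a b (Equiv.swap c d v) with hp_def
  have hp : Function.Involutive p := fun v => by grind
  have hG (v) (hv : p v ≠ v) : G.Adj v (p v) := by
    have := adj_swap_of_ne hab.1 (v := v)
    have := adj_swap_of_ne hcd.1 (v := v)
    grind
  have hH (v) : ¬H.Adj v (p v) := by
    have := not_adj_swap hab.2 v
    have := not_adj_swap hcd.2 v
    grind
  have hpa : p a = b := by grind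
  have hpb : p b = a := by grind
  have hpc : p c = d := by grind
  have hpd : p d = c := by grind
  have hpxy : y ≠ p x := by grind
  obtain ⟨u, hu, hux, huy⟩ : ∃ u, p u ≠ u ∧ u ≠ x ∧ u ≠ y := by
    by_contra! hcon
    have := hcon a
    have := hcon b
    have := hcon c
    have := hcon d
    clear hp_def hxy₁ hxy₂ hH hG
    grind
  have hpu : p (p u) ≠ p u := by grind
  refine ⟨Option V, inferInstance, G.pinch p hp, H.map some, ?_, map_some_le_pinch _ _ _ hHG hH,
    isContained_map_some hK, none, some u, some x, some y, none, some (p u), ?_⟩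
  · rw [degrees_pinch _ _ _ hG]
    congr 1
    have hset : {v | p v ≠ v} = {a, b, c, d} := by
      ext v
      simp only [hp_def, Set.mem_ofPred_eq, Set.mem_insert_iff, Set.mem_singleton_iff]
      grind
    rw [hset]
    simp [Set.ncard_insert_of_notMem, *]
  · simp [sdiff_adj, hu, hpu, hxy, hpxy, hux, huy]

theorem cons_three_cons_three (h : HasExtensibleRealization s) :
    HasExtensibleRealization (3 ::ₘ 3 ::ₘ s) := by
  classical
  obtain ⟨V, _, G, H, rfl, hHG, hK, a, b, c, d, x, y, hab, hcd, -, hac, had, hbc, hbd, -⟩ := h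
  rw [sdiff_adj] at hab hcd
  have hne := hab.1.ne
  have hne' := hcd.1.ne
  have hcd' : (G.subdivide a b).Adj (some c) (some d) :=
    (subdivide_adj_some_some _ (by grind)).2 hcd.1
  set G₂ := (G.subdivide a b).subdivide (some c) (some d) with hG₂
  have hnone (v) : G₂.Adj none (some v) ↔ v = some c ∨ v = some d :=
    subdivide_adj_none_some _ (by simpa using hne')
  have hsome : G₂.Adj (some none) (some (some a)) := by
    rw [hG₂, subdivide_adj_some_some _ (by grind), subdivide_adj_none_some _ hne]
    exact Or.inl rfl
  have hnadj : ¬G₂.Adj none (some none) := by simp [hnone]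
  refine ⟨Option (Option V), inferInstance, G₂ ⊔ edge none (some none), (H.map some).map some, ?_,
    le_sup_of_le_left (map_some_le_subdivide (map_some_le_subdivide hHG hab.2)
      (by simpa using hcd.2)), isContained_map_some (isContained_map_some hK),
    none, some (some c), some none, some (some a), none, some none, ?_⟩
  · have hdeg₁ : {w | (G₂ ⊔ edge none (some none)).Adj none w}.ncard = 3 := by
      rw [ncard_sup_edge_left (by simp) hnadj, ncard_subdivide_none (by simpa using hne')]
    have hdeg₂ : {w | (G₂ ⊔ edge none (some none)).Adj (some none) w}.ncard = 3 := by
      rw [edge_comm, ncard_sup_edge_left (by simp) fun h => hnadj h.symm,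
        ncard_subdivide_some hcd', ncard_subdivide_none hne]
    have hdeg (v) : {w | (G₂ ⊔ edge none (some none)).Adj (some (some v)) w}.ncard =
        {w | G.Adj v w}.ncard := by
      rw [ncard_sup_edge_of_ne (by simp) (by simp), ncard_subdivide_some hcd',
        ncard_subdivide_some hab.1]
    simp [-sup_adj, degrees, univ_option, Finset.insertNone, hdeg₁, hdeg₂, hdeg]
  · simp [-SimpleGraph.map_map, sdiff_adj, hnone, hsome, hac.symm, edge_adj]

theorem replicate_two_add (h : HasExtensibleRealization s) (k : ℕ) :
    HasExtensibleRealization (Multiset.replicate k 2 + s) := by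
  induction k with
  | zero => simpa
  | succ k ih => simpa [Multiset.replicate_succ] using ih.cons_two

theorem replicate_four_add (h : HasExtensibleRealization s) (k : ℕ) :
    HasExtensibleRealization (Multiset.replicate k 4 + s) := by
  induction k with
  | zero => simpa
  | succ k ih => simpa [Multiset.replicate_succ] using ih.cons_four

theorem replicate_three_add (h : HasExtensibleRealization s) (k : ℕ) :
    HasExtensibleRealization (Multiset.replicate (2 * k) 3 + s) := by
  induction k with
  | zero => simpa
  | succ k ih => simpa [Nat.mul_succ, Multiset.replicate_succ] using ih.cons_three_cons_three

end HasExtensibleRealization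

theorem isContained_map_castLE {n : ℕ} (h : 6 ≤ n) : K6C5 ⊑ K6C5.map (Fin.castLE h) :=
  (Embedding.map (Fin.castLEEmb h) K6C5).isContained

/-- The copy of `K₆ − C₅` on the vertices `0, …, 5` of `Fin n`, together with the edges listed
in `l`. -/
def K6C5Sup {n : ℕ} (h : 6 ≤ n) (l : List (Fin n × Fin n)) : SimpleGraph (Fin n) :=
  K6C5.map (Fin.castLE h) ⊔ fromRel fun u v => (u, v) ∈ l

instance {n : ℕ} (h : 6 ≤ n) : DecidableRel (K6C5.map (Fin.castLE h)).Adj := fun u v =>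
  inferInstanceAs
    (Decidable (u ≠ v ∧ ∃ a b, K6C5.Adj a b ∧ Fin.castLE h a = u ∧ Fin.castLE h b = v))

instance {n : ℕ} (h : 6 ≤ n) (l : List (Fin n × Fin n)) : DecidableRel (K6C5Sup h l).Adj :=
  fun u v => inferInstanceAs
    (Decidable ((K6C5.map (Fin.castLE h)).Adj u v ∨ (fromRel fun u v => (u, v) ∈ l).Adj u v))

theorem degrees_eq_of_decidable {V : Type} [Fintype V] (G : SimpleGraph V) [DecidableRel G.Adj] :
    G.degrees = (Finset.univ : Finset V).val.map fun v => (Finset.univ.filter (G.Adj v)).card := by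
  refine Multiset.map_congr rfl fun v _ => ?_
  rw [Set.ncard_eq_toFinset_card']
  congr 1
  ext w
  simp

theorem hasExtensibleRealization_six : HasExtensibleRealization {5, 5, 5, 4, 4, 3} := by
  refine ⟨Fin 6, inferInstance, K6C5Sup le_rfl [(1, 2), (2, 3), (3, 4)], _, ?_, le_sup_left,
    isContained_map_castLE le_rfl, 1, 2, 3, 4, 2, 3, ?_⟩
  · rw [degrees_eq_of_decidable]; decide +kernel
  · simp only [sdiff_adj]; decide +kernel

theorem hasExtensibleRealization_seven : HasExtensibleRealization {5, 5, 5, 4, 3, 3, 3} := by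
  have h : 6 ≤ 7 := by simp
  refine ⟨Fin 7, inferInstance, K6C5Sup h [(1, 2), (1, 6), (2, 6), (3, 6)], _, ?_, le_sup_left,
    isContained_map_castLE h, 1, 2, 3, 6, 1, 6, ?_⟩
  · rw [degrees_eq_of_decidable]; decide +kernel +revert
  · simp only [sdiff_adj]; decide +kernel +revert

theorem hasExtensibleRealization_eight : HasExtensibleRealization {5, 5, 5, 3, 3, 3, 3, 3} := by
  have h : 6 ≤ 8 := by simp
  refine ⟨Fin 8, inferInstance, K6C5Sup h [(1, 6), (1, 7), (2, 6), (2, 7), (6, 7)], _, ?_,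
    le_sup_left, isContained_map_castLE h, 1, 6, 2, 7, 1, 7, ?_⟩
  · rw [degrees_eq_of_decidable]; decide +kernel +revert
  · simp only [sdiff_adj]; decide +kernel +revert

theorem hasExtensibleRealization_two_two :
    HasExtensibleRealization {5, 5, 5, 3, 3, 3, 2, 2} := by
  have h : 6 ≤ 8 := by simp
  refine ⟨Fin 8, inferInstance, K6C5Sup h [(1, 2), (2, 6), (6, 7), (7, 1)], _, ?_, le_sup_left,
    isContained_map_castLE h, 1, 2, 6, 7, 2, 6, ?_⟩
  · rw [degrees_eq_of_decidable]; decide +kernel +revert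
  · simp only [sdiff_adj]; decide +kernel +revert

theorem potentiallyK6C5_two : PotentiallyK6C5 [5, 5, 5, 3, 3, 3, 2] := by
  have h : 6 ≤ 7 := by simp
  refine potentiallyK6C5_of_degrees_eq (G := K6C5Sup h [(1, 2), (2, 6), (6, 1)]) ?_
    ((isContained_map_castLE h).mono_right le_sup_left)
  rw [degrees_eq_of_decidable]; decide +kernel +revert

theorem not_potentiallyK6C5 : ¬PotentiallyK6C5 [5, 5, 5, 3, 3, 3] := by
  rintro ⟨G, hdeg, f, hf, hG⟩
  change SimpleGraph (Fin 6) at G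
  change ∀ i : Fin 6, degCount G i = _ at hdeg
  change Fin 6 → Fin 6 at f
  have hfull (i : Fin 6) (hi : degCount G i = 5) (j : Fin 6) (hij : j ≠ i) : G.Adj i j := by
    have hsub : {j | G.Adj i j} ⊆ {i}ᶜ := fun j hj => hj.ne'
    have hcompl := Set.ncard_add_ncard_compl {i}
    rw [Set.ncard_singleton, Nat.card_fin] at hcompl
    have heq := Set.eq_of_subset_of_ncard_le hsub
      (by rw [show {j | G.Adj i j}.ncard = 5 from hi]; omega)
    have : j ∈ ({i}ᶜ : Set (Fin 6)) := hij
    rwa [← heq] at this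
  have hthree (i : Fin 6) (hi : degCount G i = 3) (hi' : 3 ≤ i) (j : Fin 6) (hij : G.Adj i j) :
      j < 3 := by
    have hsub : (({0, 1, 2} : Finset (Fin 6)) : Set (Fin 6)) ⊆ {j | G.Adj i j} := by
      intro j hj
      have hj' : j = 0 ∨ j = 1 ∨ j = 2 := by simpa using hj
      refine (hfull j ?_ i ?_).symm
      · rcases hj' with rfl | rfl | rfl
        · exact hdeg 0
        · exact hdeg 1
        · exact hdeg 2
      · omega
    have heq := Set.eq_of_subset_of_ncard_le hsub
      (by rw [show {j | G.Adj i j}.ncard = 3 from hi, Set.ncard_coe_finset]; decide)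
    have : j ∈ {j | G.Adj i j} := hij
    rw [← heq] at this
    have hj' : j = 0 ∨ j = 1 ∨ j = 2 := by simpa using this
    omega
  have hsurj := Finite.surjective_of_injective hf
  obtain ⟨a, ha⟩ := hsurj 3
  obtain ⟨b, hb⟩ := hsurj 4
  obtain ⟨c, hc⟩ := hsurj 5
  have hab : ¬K6C5.Adj a b := fun h => by
    have := hG a b h
    rw [ha, hb] at this
    exact absurd (hthree 3 (hdeg 3) le_rfl 4 this) (by decide)
  have hac : ¬K6C5.Adj a c := fun h => by
    have := hG a c h
    rw [ha, hc] at this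
    exact absurd (hthree 3 (hdeg 3) le_rfl 5 this) (by decide)
  have hbc : ¬K6C5.Adj b c := fun h => by
    have := hG b c h
    rw [hb, hc] at this
    exact absurd (hthree 4 (hdeg 4) (by decide) 5 this) (by decide)
  have key : ∀ a b c : Fin 6, a ≠ b → a ≠ c → b ≠ c →
      K6C5.Adj a b ∨ K6C5.Adj a c ∨ K6C5.Adj b c := by decide +kernel
  have := key a b c (by rintro rfl; simp [ha] at hb) (by rintro rfl; simp [ha] at hc)
    (by rintro rfl; simp [hb] at hc)
  tauto

theorem lemma27_2 (n i j : ℕ) (hn : 6 ≤ n) (hij : 3 ≤ i + j) (hijn : i + j ≤ n - 3)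
    (heven : Even ((List.replicate 3 5 ++ List.replicate i 4 ++ List.replicate j 3 ++
        List.replicate (n - 3 - i - j) 2).sum)) :
    PotentiallyK6C5 (List.replicate 3 5 ++ List.replicate i 4 ++ List.replicate j 3 ++
        List.replicate (n - 3 - i - j) 2) ↔
      (List.replicate 3 5 ++ List.replicate i 4 ++ List.replicate j 3 ++
        List.replicate (n - 3 - i - j) 2) ≠ [5, 5, 5, 3, 3, 3] := by
  constructor
  · intro h heq
    rw [heq] at h
    exact not_potentiallyK6C5 h
  intro hne
  generalize n - 3 - i - j = k at *
  have hj : Odd j := by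
    simp only [List.sum_append, List.sum_replicate, smul_eq_mul] at heven
    grind
  obtain ⟨m, rfl⟩ := hj
  have of_base {s : Multiset ℕ} (hs : HasExtensibleRealization s) (i' m' k' : ℕ)
      (h : Multiset.replicate i' 4 + (Multiset.replicate (2 * m') 3 +
          (Multiset.replicate k' 2 + s)) =
        Multiset.replicate 3 5 + Multiset.replicate i 4 + Multiset.replicate (2 * m + 1) 3 +
          Multiset.replicate k 2) :
      PotentiallyK6C5 (List.replicate 3 5 ++ List.replicate i 4 ++
        List.replicate (2 * m + 1) 3 ++ List.replicate k 2) := by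
    refine HasExtensibleRealization.potentiallyK6C5 ?_
    have := ((hs.replicate_two_add k').replicate_three_add m').replicate_four_add i'
    rw [h] at this
    simpa only [← Multiset.coe_add, Multiset.coe_replicate] using this
  obtain hi | rfl | rfl : 2 ≤ i ∨ i = 1 ∨ i = 0 := by omega
  · refine of_base hasExtensibleRealization_six (i - 2) m k ?_
    ext a
    simp only [Multiset.count_add, Multiset.count_replicate, Multiset.insert_eq_cons,
      Multiset.count_cons, Multiset.count_singleton]
    grind
  · refine of_base hasExtensibleRealization_seven 0 (m - 1) k ?_
    ext a
    simp only [Multiset.count_add, Multiset.count_replicate, Multiset.insert_eq_cons,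
      Multiset.count_cons, Multiset.count_singleton]
    grind
  · obtain hm | rfl : 2 ≤ m ∨ m = 1 := by omega
    · refine of_base hasExtensibleRealization_eight 0 (m - 2) k ?_
      ext a
      simp only [Multiset.count_add, Multiset.count_replicate, Multiset.insert_eq_cons,
        Multiset.count_cons, Multiset.count_singleton]
      grind
    · obtain hk | rfl | rfl : 2 ≤ k ∨ k = 1 ∨ k = 0 := by omega
      · refine of_base hasExtensibleRealization_two_two 0 0 (k - 2) ?_
        ext a
        simp only [Multiset.count_add, Multiset.count_replicate, Multiset.insert_eq_cons,
          Multiset.count_cons, Multiset.count_singleton]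
        grind
      · exact potentiallyK6C5_two
      · exact absurd rfl hne
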